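/- arXiv:1506.07449 — 2 statements merged into one kernel-verified Lean document; each statement's English description precedes it below -/
import Mathlib

section
/- The Bell numbers B_n are the Catalan-like numbers for σ = τ = (1,2,3,4,...): if r_{0,0} = 1 and r_{n+1,k} = r_{n,k−1} + (k+1) r_{n,k} + (k+1) r_{n,k+1}, then r_{n,0} = B_n for all n. (In this case the recursive matrix R is the matrix of Stirling numbers of the second kind.) -/
/-- The `n`-th Bell number: the number of partitions of an `n`-element set,
i.e. the number of equivalence relations (setoids) on `Fin n`. -/
noncomputable def bellNumber (n : ℕ) : ℕ := Nat.card (Setoid (Fin n))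

noncomputable instance fintypeSetoidFin (n : ℕ) : Fintype (Setoid (Fin n)) := by
  classical
  haveI : Finite (Setoid (Fin n)) :=
    Finite.of_injective (fun s : Setoid (Fin n) => s.r) (fun s t h => by
      ext a b
      exact iff_of_eq (congrFun (congrFun h a) b))
  exact Fintype.ofFinite _

noncomputable instance fintypeQuotFin (n : ℕ) (s : Setoid (Fin n)) : Fintype (Quotient s) :=
  Fintype.ofFinite _

def extFun {n : ℕ} (s : Setoid (Fin n)) (o : Option (Quotient s)) :
    Fin (n + 1) → Option (Quotient s) :=
  Fin.cases o (fun a => some (Quotient.mk s a))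

@[simp] lemma extFun_zero {n : ℕ} (s : Setoid (Fin n)) (o : Option (Quotient s)) :
    extFun s o 0 = o := rfl

@[simp] lemma extFun_succ {n : ℕ} (s : Setoid (Fin n)) (o : Option (Quotient s)) (a : Fin n) :
    extFun s o a.succ = some (Quotient.mk s a) := rfl

def extSetoid {n : ℕ} (p : Σ s : Setoid (Fin n), Option (Quotient s)) : Setoid (Fin (n + 1)) :=
  Setoid.ker (extFun p.1 p.2)

lemma extSetoid_inj {n : ℕ} : Function.Injective (extSetoid (n := n)) := by
  rintro ⟨s, o⟩ ⟨t, u⟩ h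
  have key : ∀ a b, (extFun s o a = extFun s o b) ↔ (extFun t u a = extFun t u b) := by
    intro a b
    have := congrArg (fun z : Setoid (Fin (n + 1)) => z a b) h
    exact iff_of_eq this
  have hst : s = t := by
    ext a b
    have := key a.succ b.succ
    simp only [extFun_succ, Option.some.injEq] at this
    rw [Quotient.eq, Quotient.eq] at this
    exact this
  subst hst
  congr 1
  have h2 : ∀ q, o = some q ↔ u = some q := by
    intro q
    induction q using Quotient.inductionOn with
    | h a => simpa using key 0 a.succ
  exact Option.ext h2

lemma extSetoid_surj {n : ℕ} : Function.Surjective (extSetoid (n := n)) := by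
  classical
  intro t
  let s : Setoid (Fin n) := Setoid.comap Fin.succ t
  have hs : ∀ a b, Quotient.mk s a = Quotient.mk s b ↔ t a.succ b.succ := by
    intro a b
    rw [Quotient.eq]
    exact Iff.rfl
  obtain ⟨o, ho⟩ : ∃ o : Option (Quotient s), ∀ a, o = some (Quotient.mk s a) ↔ t 0 a.succ := by
    by_cases h : ∃ a : Fin n, t 0 a.succ
    · obtain ⟨a, ha⟩ := h
      refine ⟨some (Quotient.mk s a), fun b => ?_⟩
      rw [Option.some.injEq, hs]
      exact ⟨fun h => t.trans ha h, fun h => t.trans (t.symm ha) h⟩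
    · push Not at h
      refine ⟨none, fun b => ?_⟩
      simp [h b]
  refine ⟨⟨s, o⟩, ?_⟩
  ext a b
  change extFun s o a = extFun s o b ↔ _
  induction a using Fin.cases with
  | zero =>
    induction b using Fin.cases with
    | zero => simpa using t.refl 0
    | succ b => simpa using ho b
  | succ a =>
    induction b using Fin.cases with
    | zero =>
      rw [eq_comm]
      exact (ho a).trans ⟨fun h => t.symm h, fun h => t.symm h⟩
    | succ b => simpa using hs a b

lemma card_ext {n : ℕ} (s : Setoid (Fin n)) (o : Option (Quotient s)) :
    Nat.card (Quotient (extSetoid ⟨s, o⟩)) =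
      Nat.card (Quotient s) + (if o = none then 1 else 0) := by
  have e : Nat.card (Quotient (extSetoid ⟨s, o⟩)) = Nat.card (Set.range (extFun s o)) :=
    Nat.card_congr (Setoid.quotientKerEquivRange (extFun s o))
  rw [e]
  cases o with
  | none =>
    have : Set.range (extFun s none) = Set.univ := by
      rw [Set.range_eq_univ]
      rintro (_ | q)
      · exact ⟨0, rfl⟩
      · induction q using Quotient.inductionOn with
        | h a => exact ⟨a.succ, rfl⟩
    rw [this]
    simp
  | some q =>
    have : Set.range (extFun s (some q)) = Set.range (some : Quotient s → _) := by
      ext x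
      constructor
      · rintro ⟨a, rfl⟩
        induction a using Fin.cases with
        | zero => exact ⟨q, rfl⟩
        | succ a => exact ⟨_, rfl⟩
      · rintro ⟨q, rfl⟩
        induction q using Quotient.inductionOn with
        | h a => exact ⟨a.succ, rfl⟩
    rw [this, Nat.card_range_of_injective (Option.some_injective _)]
    simp

lemma sum_succ (n : ℕ) (f : ℕ → ℝ) :
    ∑ s : Setoid (Fin (n + 1)), f (Nat.card (Quotient s)) =
      ∑ s : Setoid (Fin n), (f (Nat.card (Quotient s) + 1) +
        (Nat.card (Quotient s) : ℝ) * f (Nat.card (Quotient s))) := by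
  rw [← Function.Bijective.sum_comp ⟨extSetoid_inj, extSetoid_surj⟩
    (fun s => f (Nat.card (Quotient s))), Fintype.sum_sigma]
  refine Finset.sum_congr rfl fun s _ => ?_
  simp only [card_ext]
  rw [Fintype.sum_option]
  simp

lemma choose_id (b k : ℕ) :
    (b : ℝ) * (b.choose k : ℝ) = k * b.choose k + (k + 1) * b.choose (k + 1) := by
  have h := Nat.choose_succ_right_eq b k
  rcases le_or_gt k b with hk | hk
  · have h' : (b.choose (k + 1) : ℝ) * (k + 1) = b.choose k * ((b : ℝ) - k) := by
      rw [← Nat.cast_sub hk]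
      exact_mod_cast h
    linarith
  · rw [Nat.choose_eq_zero_of_lt hk, Nat.choose_eq_zero_of_lt (by omega)]
    simp

theorem stmt_15 (r : ℕ → ℕ → ℝ)
    (h00 : r 0 0 = 1)
    (hz : ∀ n k : ℕ, n < k → r n k = 0)
    (hrec : ∀ n k : ℕ, r (n + 1) k =
      (if k = 0 then 0 else r n (k - 1)) + (k + 1 : ℝ) * r n k + (k + 1 : ℝ) * r n (k + 1)) :
    ∀ n : ℕ, r n 0 = (bellNumber n : ℝ) := by
  have main : ∀ n k, r n k =
      ∑ s : Setoid (Fin n), ((Nat.card (Quotient s)).choose k : ℝ) := by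
    intro n
    induction n with
    | zero =>
      intro k
      haveI : Unique (Setoid (Fin 0)) :=
        ⟨⟨⊥⟩, fun s => by ext a; exact a.elim0⟩
      rw [Fintype.sum_unique]
      have : Nat.card (Quotient (default : Setoid (Fin 0))) = 0 := by
        simp
      rw [this]
      cases k with
      | zero => simpa using h00
      | succ k => simpa using hz 0 (k + 1) (by omega)
    | succ n ih =>
      intro k
      rw [hrec, sum_succ n (fun b => (b.choose k : ℝ))]
      simp only [ih, choose_id]
      cases k with
      | zero =>
        simp [Finset.sum_add_distrib]
      | succ k =>
        simp only [Nat.choose_succ_succ' _ k, Nat.succ_ne_zero, if_false, Nat.add_sub_cancel,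
          Finset.mul_sum, ← Finset.sum_add_distrib]
        refine Finset.sum_congr rfl fun s _ => ?_
        push_cast
        ring
  intro n
  rw [main]
  simp [bellNumber]
end

section
/- The factorial numbers n! are the Catalan-like numbers for σ = (1,3,5,7,...) and τ = (1,4,9,16,...): if r_{0,0} = 1 and r_{n+1,k} = r_{n,k−1} + (2k+1) r_{n,k} + (k+1)² r_{n,k+1}, then r_{n,0} = n! for all n. -/
theorem choose_aux (n k : ℕ) : ((n:ℝ)+1) * (n.choose k : ℝ) = ((n.choose k : ℝ) + (n.choose (k+1) : ℝ)) * ((k:ℝ)+1) := by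
  have h := Nat.add_one_mul_choose_eq n k
  rw [Nat.choose_succ_succ] at h
  exact_mod_cast h

theorem stmt_16 (r : ℕ → ℕ → ℝ)
    (h00 : r 0 0 = 1)
    (hz : ∀ n k : ℕ, n < k → r n k = 0)
    (hrec : ∀ n k : ℕ, r (n + 1) k =
      (if k = 0 then 0 else r n (k - 1)) + (2 * k + 1 : ℝ) * r n k
        + ((k + 1 : ℝ)) ^ 2 * r n (k + 1)) :
    ∀ n : ℕ, r n 0 = (Nat.factorial n : ℝ) := by
  have key : ∀ n k : ℕ, r n k * (k.factorial : ℝ) = (n.choose k : ℝ) * (n.factorial : ℝ) := by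
    intro n
    induction n with
    | zero =>
      intro k
      rcases k with _ | k
      · simp [h00]
      · simp [hz 0 (k+1) (by omega)]
    | succ n ih =>
      intro k
      rcases k with _ | j
      · have h0 := ih 0
        have h1 := ih 1
        have hr := hrec n 0
        simp [Nat.factorial_succ] at h0 h1 hr ⊢
        rw [hr, h0, h1]; ring
      · have h0 := ih j
        have h1 := ih (j+1)
        have h2 := ih (j+2)
        have hr := hrec n (j+1)
        have c1 := choose_aux n j
        have c2 := choose_aux n (j+1)
        rw [if_neg (by omega)] at hr
        simp only [Nat.add_sub_cancel] at hr
        rw [hr, Nat.choose_succ_succ]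
        simp only [Nat.factorial_succ, Nat.succ_eq_add_one, add_assoc, Nat.reduceAdd] at h0 h1 h2 c1 c2 ⊢
        push_cast at h0 h1 h2 c1 c2 ⊢
        linear_combination ((j:ℝ)+1) * h0 + (2*j+3) * h1 + (j+2) * h2 - (n.factorial : ℝ) * c2 - (n.factorial : ℝ) * c1
  intro n
  simpa using key n 0
end
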